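/- Let A = [a⁻,a⁺] and B be distinct arcs on the N-point circle (N ≥ 3), neither of them complete, with a⁻ ≠ a⁺, and suppose no extreme point of A is an extreme point of B. Let Ã = [a⁺,a⁻] be the flip of A. Then |Ã| = N − |A| + 2, and: (i) if A ∩ B = ∅ then |Ã ∩ B| = |B|; (ii) if A ⊆ B then |Ã ∩ B| = |B| − |A| + 2; (iii) if B ⊆ A then Ã ∩ B = ∅; (iv) if A ⋈ B (A and B form a circle cover) then |Ã ∩ B| = N − |A| + 2; (v) if A and B strictly overlap (A ≬* B) then |Ã ∩ B| = |B| − |A ∩ B| + 1. -/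

import Mathlib

/-- The arc `[a,b]` on the `N`-point circle. -/
def arcIcc (N : ℕ) (a b : ZMod N) : Set (ZMod N) := {x | (x - a).val ≤ (b - a).val}

/-- The point set of an arc given with its designated extreme points `p = (p.1, p.2)`. -/
def arcPts {N : ℕ} (p : ZMod N × ZMod N) : Set (ZMod N) := arcIcc N p.1 p.2

/-- Two sets *overlap*: they intersect but neither includes the other. -/
def SetsOverlap {β : Type*} (A B : Set β) : Prop :=
  (A ∩ B).Nonempty ∧ ¬A ⊆ B ∧ ¬B ⊆ A

/-- Two arcs *strictly overlap*: they overlap and do not cover the whole circle. -/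
def StrictOv {N : ℕ} (A B : Set (ZMod N)) : Prop :=
  SetsOverlap A B ∧ A ∪ B ≠ Set.univ

/-- Arcs with designated extreme points form a *circle cover* (`p ⋈ q`):
their union is the whole circle and each contains both extreme points of the other. -/
def CircleCover {N : ℕ} (p q : ZMod N × ZMod N) : Prop :=
  arcPts p ∪ arcPts q = Set.univ ∧
    q.1 ∈ arcPts p ∧ q.2 ∈ arcPts p ∧ p.1 ∈ arcPts q ∧ p.2 ∈ arcPts q

theorem ZMod.val_sub_eq_ite {N : ℕ} [NeZero N] (x a : ZMod N) :
    (x - a).val = if a.val ≤ x.val then x.val - a.val else x.val + N - a.val := by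
  have hx := x.val_lt
  have ha := a.val_lt
  split_ifs with h
  · exact ZMod.val_sub h
  · have h1 : (x - a).val = (x.val + N - a.val) % N := by
      rw [← ZMod.val_natCast, Nat.cast_sub (by omega)]
      simp
    rw [h1, Nat.mod_eq_of_lt (by omega)]

/-- Membership in an arc, expressed through the representatives in `{0, …, N - 1}`. -/
theorem mem_arcIcc_iff {N : ℕ} [NeZero N] (a b x : ZMod N) :
    x ∈ arcIcc N a b ↔
      (a.val ≤ b.val ∧ a.val ≤ x.val ∧ x.val ≤ b.val) ∨
        (b.val < a.val ∧ (a.val ≤ x.val ∨ x.val ≤ b.val)) := by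
  have hx := x.val_lt
  have ha := a.val_lt
  have hb := b.val_lt
  simp only [arcIcc, Set.mem_ofPred_eq, ZMod.val_sub_eq_ite]
  split_ifs <;> omega

theorem left_mem_arcIcc {N : ℕ} (a b : ZMod N) : a ∈ arcIcc N a b := by
  simp [arcIcc]

theorem right_mem_arcIcc {N : ℕ} (a b : ZMod N) : b ∈ arcIcc N a b := by
  simp [arcIcc]

theorem arcIcc_flip {N : ℕ} [NeZero N] {a b : ZMod N} (h : a ≠ b) :
    arcIcc N b a = (arcIcc N a b)ᶜ ∪ {a, b} := by
  have h' : a.val ≠ b.val := fun e => h (ZMod.val_injective N e)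
  ext x
  simp only [Set.mem_union, Set.mem_compl_iff, Set.mem_insert_iff, Set.mem_singleton_iff,
    mem_arcIcc_iff, ← (ZMod.val_injective N).eq_iff]
  omega

/-- An arc avoiding both extreme points of `[a,b]` lies inside `[a,b]` or is disjoint from it. -/
theorem arcIcc_subset_or_disjoint {N : ℕ} [NeZero N] {a b c d : ZMod N}
    (ha : a ∉ arcIcc N c d) (hb : b ∉ arcIcc N c d) :
    arcIcc N c d ⊆ arcIcc N a b ∨ arcIcc N a b ∩ arcIcc N c d = ∅ := by
  by_cases hc : c ∈ arcIcc N a b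
  · left
    intro x hx
    rw [mem_arcIcc_iff] at *
    omega
  · right
    ext x
    simp only [Set.mem_inter_iff, Set.mem_empty_iff_false, iff_false, not_and]
    intro hx hx'
    rw [mem_arcIcc_iff] at *
    omega

/-- An arc containing both extreme points of `[a,b]` includes `[a,b]` or covers the circle
together with it. -/
theorem arcIcc_subset_or_union_eq_univ {N : ℕ} [NeZero N] {a b c d : ZMod N}
    (ha : a ∈ arcIcc N c d) (hb : b ∈ arcIcc N c d) :
    arcIcc N a b ⊆ arcIcc N c d ∨ arcIcc N a b ∪ arcIcc N c d = Set.univ := by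
  by_contra! ⟨h₁, h₂⟩
  obtain ⟨x, hx, hx'⟩ := Set.not_subset.mp h₁
  obtain ⟨y, hy⟩ := (Set.ne_univ_iff_exists_notMem _).mp h₂
  rw [Set.mem_union, not_or] at hy
  obtain ⟨hy, hy'⟩ := hy
  rw [mem_arcIcc_iff] at *
  omega

/-- A subarc of a non-complete arc `[a,b]` having neither `a` nor `b` as an extreme point
contains neither of them. -/
theorem notMem_of_arcIcc_subset {N : ℕ} [NeZero N] {a b c d : ZMod N}
    (hA : arcIcc N a b ≠ Set.univ) (hac : a ≠ c) (hbd : b ≠ d)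
    (h : arcIcc N c d ⊆ arcIcc N a b) :
    a ∉ arcIcc N c d ∧ b ∉ arcIcc N c d := by
  have hac' : a.val ≠ c.val := fun e => hac (ZMod.val_injective N e)
  have hbd' : b.val ≠ d.val := fun e => hbd (ZMod.val_injective N e)
  obtain ⟨y, hy⟩ := (Set.ne_univ_iff_exists_notMem _).mp hA
  have hy' : y ∉ arcIcc N c d := fun e => hy (h e)
  have hc := h (left_mem_arcIcc c d)
  have hd := h (right_mem_arcIcc c d)
  rw [mem_arcIcc_iff] at *
  rw [mem_arcIcc_iff]
  omega

/-- Let `A = [a⁻,a⁺]` and `B = [b⁻,b⁺]` be distinct non-complete arcs on the `N`-point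
circle (`N ≥ 3`) with `a⁻ ≠ a⁺` and no common extreme point, and let `Ã = [a⁺,a⁻]` be
the flip of `A`.  Then `|Ã| = N - |A| + 2`, and:
(i) if `A ∩ B = ∅` then `|Ã ∩ B| = |B|`;
(ii) if `A ⊆ B` then `|Ã ∩ B| = |B| - |A| + 2`;
(iii) if `B ⊆ A` then `Ã ∩ B = ∅`;
(iv) if `A ⋈ B` then `|Ã ∩ B| = N - |A| + 2`;
(v) if `A ≬* B` then `|Ã ∩ B| = |B| - |A ∩ B| + 1`. -/
theorem stmt18 {N : ℕ} (hN : 3 ≤ N) (am ap bm bp : ZMod N)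
    (hdistinct : arcIcc N am ap ≠ arcIcc N bm bp)
    (hAnc : arcIcc N am ap ≠ Set.univ) (hBnc : arcIcc N bm bp ≠ Set.univ)
    (haa : am ≠ ap)
    (hext : am ≠ bm ∧ am ≠ bp ∧ ap ≠ bm ∧ ap ≠ bp) :
    (arcIcc N ap am).ncard = N - (arcIcc N am ap).ncard + 2 ∧
    (arcIcc N am ap ∩ arcIcc N bm bp = ∅ →
      (arcIcc N ap am ∩ arcIcc N bm bp).ncard = (arcIcc N bm bp).ncard) ∧
    (arcIcc N am ap ⊆ arcIcc N bm bp →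
      (arcIcc N ap am ∩ arcIcc N bm bp).ncard =
        (arcIcc N bm bp).ncard - (arcIcc N am ap).ncard + 2) ∧
    (arcIcc N bm bp ⊆ arcIcc N am ap →
      arcIcc N ap am ∩ arcIcc N bm bp = ∅) ∧
    (CircleCover (am, ap) (bm, bp) →
      (arcIcc N ap am ∩ arcIcc N bm bp).ncard = N - (arcIcc N am ap).ncard + 2) ∧
    (StrictOv (arcIcc N am ap) (arcIcc N bm bp) →
      (arcIcc N ap am ∩ arcIcc N bm bp).ncard =
        (arcIcc N bm bp).ncard - (arcIcc N am ap ∩ arcIcc N bm bp).ncard + 1) := by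
  have : NeZero N := ⟨by omega⟩
  obtain ⟨h₁, -, -, h₄⟩ := hext
  have hflip := arcIcc_flip haa
  have hcov := @arcIcc_subset_or_union_eq_univ N _ am ap bm bp
  have havoid := @arcIcc_subset_or_disjoint N _ am ap bm bp
  have hsub := @notMem_of_arcIcc_subset N _ am ap bm bp hAnc h₁ h₄
  have ham := left_mem_arcIcc am ap
  have hap := right_mem_arcIcc am ap
  rw [hflip]
  simp only [CircleCover, StrictOv, SetsOverlap, arcPts]
  generalize arcIcc N am ap = A at *
  generalize arcIcc N bm bp = B at *
  have hcompl : Aᶜ.ncard = N - A.ncard := by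
    rw [Set.ncard_compl, Nat.card_zmod]
  have hdiff : (B \ A).ncard = B.ncard - (A ∩ B).ncard := by
    have := Set.ncard_inter_add_ncard_sdiff_eq_ncard B A
    rw [Set.inter_comm] at this
    omega
  have hAtilde : (Aᶜ ∪ {am, ap}).ncard = N - A.ncard + 2 := by
    rw [Set.ncard_union_eq, hcompl, Set.ncard_pair haa]
    rw [Set.disjoint_left]
    rintro x hx (rfl | rfl) <;> contradiction
  refine ⟨hAtilde, fun h => ?_, fun h => ?_, fun h => ?_, fun h => ?_, fun h => ?_⟩
  · congr 1
    rw [Set.inter_eq_right]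
    exact fun x hx => Or.inl fun hx' => (h ▸ ⟨hx', hx⟩ : x ∈ (∅ : Set (ZMod N)))
  · have e : (Aᶜ ∪ {am, ap}) ∩ B = B \ A ∪ {am, ap} := by
      ext x
      have hm := h ham
      have hp := h hap
      simp only [Set.mem_inter_iff, Set.mem_union, Set.mem_compl_iff, Set.mem_sdiff,
        Set.mem_insert_iff, Set.mem_singleton_iff]
      grind
    rw [e, Set.ncard_union_eq, hdiff, Set.ncard_pair haa, Set.inter_eq_left.mpr h]
    rw [Set.disjoint_left]
    rintro x hx (rfl | rfl) <;> exact hx.2 ‹_›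
  · obtain ⟨hm, hp⟩ := hsub h
    ext x
    have hx := @h x
    simp only [Set.mem_inter_iff, Set.mem_union, Set.mem_compl_iff,
      Set.mem_insert_iff, Set.mem_singleton_iff, Set.mem_empty_iff_false]
    grind
  · obtain ⟨hu, -, -, hm, hp⟩ := h
    rw [Set.inter_eq_left.mpr, hAtilde]
    rintro x (hx | rfl | rfl)
    · exact (hu ▸ Set.mem_univ x : x ∈ A ∪ B).resolve_left hx
    · exact hm
    · exact hp
  · obtain ⟨⟨hne, hAB, hBA⟩, hu⟩ := h
    rw [← hdiff]
    have hexact : (am ∈ B ∧ ap ∉ B) ∨ (am ∉ B ∧ ap ∈ B) := by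
      have := hne.ne_empty
      tauto
    obtain ⟨p, hp, e⟩ : ∃ p ∈ A, (Aᶜ ∪ {am, ap}) ∩ B = insert p (B \ A) := by
      rcases hexact with ⟨hm, hp⟩ | ⟨hm, hp⟩
      · refine ⟨am, ham, ?_⟩
        ext x
        simp only [Set.mem_inter_iff, Set.mem_union, Set.mem_compl_iff, Set.mem_sdiff,
          Set.mem_insert_iff, Set.mem_singleton_iff]
        grind
      · refine ⟨ap, hap, ?_⟩
        ext x
        simp only [Set.mem_inter_iff, Set.mem_union, Set.mem_compl_iff, Set.mem_sdiff,
          Set.mem_insert_iff, Set.mem_singleton_iff]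
        grind
    rw [e, Set.ncard_insert_of_notMem fun h => h.2 hp]
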